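/- arXiv:1911.08833 — 10 statements merged into one kernel-verified Lean document; each statement's English description precedes it below -/
import Mathlib

section
/- Let ÷ be an AGM contraction operator for epistemic states. Then the following are equivalent: (a) ÷ satisfies (C8) [if ¬α ⊨ β then Mod(Ψ÷α÷β) ∩ α = Mod(Ψ÷β) ∩ α, for all Ψ, α, β] and (C9) [if α ⊨ β then Mod(Ψ÷α÷β) ∩ ¬β = Mod(Ψ÷β) ∩ ¬β, for all Ψ, α, β]; (b) there is a faithful assignment Ψ ↦ ≤_Ψ representing ÷ that satisfies (CR8) [for ω₁, ω₂ ∈ α: ω₁ ≤_Ψ ω₂ ⟺ ω₁ ≤_{Ψ÷α} ω₂] and (CR9) [for ω₁, ω₂ ∈ ¬α: ω₁ ≤_Ψ ω₂ ⟺ ω₁ ≤_{Ψ÷α} ω₂]. -/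
namespace IteratedContraction

variable {W E : Type*}

/-- A total preorder: reflexive, transitive and total relation. -/
def IsTotalPreorder (r : W → W → Prop) : Prop :=
  Reflexive r ∧ Transitive r ∧ ∀ x y, r x y ∨ r y x

/-- `minSet r S` is the set of `r`-minimal elements of `S`. -/
def minSet (r : W → W → Prop) (S : Set W) : Set W :=
  {ω | ω ∈ S ∧ ∀ ω' ∈ S, r ω ω'}

/-- Strict variant of a (total pre)order. -/
def strictLt (r : W → W → Prop) (x y : W) : Prop := r x y ∧ ¬ r y x

/-- A faithful assignment maps each epistemic state to a total preorder on worlds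
such that all models of the state are mutually equivalent (FA1) and strictly below
every non-model (FA2). -/
def FaithfulAssignment (Mod : E → Set W) (le : E → W → W → Prop) : Prop :=
  (∀ Ψ, IsTotalPreorder (le Ψ)) ∧
  (∀ Ψ, ∀ ω₁ ∈ Mod Ψ, ∀ ω₂ ∈ Mod Ψ, le Ψ ω₁ ω₂ ∧ le Ψ ω₂ ω₁) ∧
  (∀ Ψ, ∀ ω₁ ∈ Mod Ψ, ∀ ω₂, ω₂ ∉ Mod Ψ → strictLt (le Ψ) ω₁ ω₂)

/-- The assignment represents the contraction `div`:
`Mod (Ψ ÷ α) = Mod Ψ ∪ min(¬α, ≤_Ψ)`. -/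
def Represents (Mod : E → Set W) (div : E → Set W → E) (le : E → W → W → Prop) : Prop :=
  ∀ Ψ α, Mod (div Ψ α) = Mod Ψ ∪ minSet (le Ψ) αᶜ

/-- (C8): if ¬α ⊨ β then Bel(Ψ÷α÷β) =_α Bel(Ψ÷β). -/
def C8 (Mod : E → Set W) (div : E → Set W → E) : Prop :=
  ∀ (Ψ : E) (α β : Set W), αᶜ ⊆ β →
    Mod (div (div Ψ α) β) ∩ α = Mod (div Ψ β) ∩ α

/-- (C9): if α ⊨ β then Bel(Ψ÷α÷β) =_{¬β} Bel(Ψ÷β). -/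
def C9 (Mod : E → Set W) (div : E → Set W → E) : Prop :=
  ∀ (Ψ : E) (α β : Set W), α ⊆ β →
    Mod (div (div Ψ α) β) ∩ βᶜ = Mod (div Ψ β) ∩ βᶜ

/-- (C10): if ¬α ⊨ γ then Ψ÷β ⊨ γ implies Ψ÷α÷β ⊨ γ. -/
def C10 (Mod : E → Set W) (div : E → Set W → E) : Prop :=
  ∀ (Ψ : E) (α β γ : Set W), αᶜ ⊆ γ →
    Mod (div Ψ β) ⊆ γ → Mod (div (div Ψ α) β) ⊆ γ

/-- (C11): if α ⊨ γ then Ψ÷α÷β ⊨ γ implies Ψ÷β ⊨ γ. -/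
def C11 (Mod : E → Set W) (div : E → Set W → E) : Prop :=
  ∀ (Ψ : E) (α β γ : Set W), α ⊆ γ →
    Mod (div (div Ψ α) β) ⊆ γ → Mod (div Ψ β) ⊆ γ

/-- (C8cond): if ¬α ⊨ β then Ψ÷α ⊨ ((γ ∨ ¬α) ⇃ β) ⟺ Ψ ⊨ ((γ ∨ ¬α) ⇃ β). -/
def C8cond (Mod : E → Set W) (div : E → Set W → E) : Prop :=
  ∀ (Ψ : E) (α β γ : Set W), αᶜ ⊆ β →
    (Mod (div (div Ψ α) β) ⊆ γ ∪ αᶜ ↔ Mod (div Ψ β) ⊆ γ ∪ αᶜ)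

/-- (C9cond): if α ⊨ β then Ψ÷α ⊨ ((γ ∨ β) ⇃ β) ⟺ Ψ ⊨ ((γ ∨ β) ⇃ β). -/
def C9cond (Mod : E → Set W) (div : E → Set W → E) : Prop :=
  ∀ (Ψ : E) (α β γ : Set W), α ⊆ β →
    (Mod (div (div Ψ α) β) ⊆ γ ∪ β ↔ Mod (div Ψ β) ⊆ γ ∪ β)

/-- (C10cond): if ¬α ⊨ γ then Ψ ⊨ (γ ⇃ β) implies Ψ÷α ⊨ (γ ⇃ β). -/
def C10cond (Mod : E → Set W) (div : E → Set W → E) : Prop :=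
  ∀ (Ψ : E) (α β γ : Set W), αᶜ ⊆ γ →
    Mod (div Ψ β) ⊆ γ → Mod (div (div Ψ α) β) ⊆ γ

/-- (C11cond): if α ⊨ γ then Ψ÷α ⊨ (γ ⇃ β) implies Ψ ⊨ (γ ⇃ β). -/
def C11cond (Mod : E → Set W) (div : E → Set W → E) : Prop :=
  ∀ (Ψ : E) (α β γ : Set W), α ⊆ γ →
    Mod (div (div Ψ α) β) ⊆ γ → Mod (div Ψ β) ⊆ γ

/-- (IC8): Bel(Φ) ⊆ Bel(Φ') is rendered as Mod(Φ') ⊆ Mod(Φ). -/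
def IC8 (Mod : E → Set W) (div : E → Set W → E) : Prop :=
  ∀ (Ψ : E) (α β γ : Set W), αᶜ ⊆ γ →
    (Mod (div Ψ (α ∪ β)) ⊆ Mod (div Ψ α) ↔
      Mod (div (div Ψ γ) (α ∪ β)) ⊆ Mod (div (div Ψ γ) α))

def IC9 (Mod : E → Set W) (div : E → Set W → E) : Prop :=
  ∀ (Ψ : E) (α β γ : Set W), γ ⊆ α →
    (Mod (div Ψ (α ∪ β)) ⊆ Mod (div Ψ α) ↔
      Mod (div (div Ψ γ) (α ∪ β)) ⊆ Mod (div (div Ψ γ) α))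

def IC10 (Mod : E → Set W) (div : E → Set W → E) : Prop :=
  ∀ (Ψ : E) (α β γ : Set W), βᶜ ⊆ γ →
    (Mod (div (div Ψ γ) (α ∪ β)) ⊆ Mod (div (div Ψ γ) α) →
      Mod (div Ψ (α ∪ β)) ⊆ Mod (div Ψ α))

def IC11 (Mod : E → Set W) (div : E → Set W → E) : Prop :=
  ∀ (Ψ : E) (α β γ : Set W), γ ⊆ β →
    (Mod (div (div Ψ γ) (α ∪ β)) ⊆ Mod (div (div Ψ γ) α) →
      Mod (div Ψ (α ∪ β)) ⊆ Mod (div Ψ α))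

/-- (CR8): worlds inside α keep their relative order after contraction by α. -/
def CR8 (div : E → Set W → E) (le : E → W → W → Prop) : Prop :=
  ∀ (Ψ : E) (α : Set W), ∀ ω₁ ∈ α, ∀ ω₂ ∈ α,
    (le Ψ ω₁ ω₂ ↔ le (div Ψ α) ω₁ ω₂)

/-- (CR9): worlds inside ¬α keep their relative order after contraction by α. -/
def CR9 (div : E → Set W → E) (le : E → W → W → Prop) : Prop :=
  ∀ (Ψ : E) (α : Set W), ∀ ω₁ ∈ αᶜ, ∀ ω₂ ∈ αᶜ,
    (le Ψ ω₁ ω₂ ↔ le (div Ψ α) ω₁ ω₂)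

/-- (CR10). -/
def CR10 (div : E → Set W → E) (le : E → W → W → Prop) : Prop :=
  ∀ (Ψ : E) (α : Set W), ∀ ω₁ ∈ αᶜ, ∀ ω₂ ∈ α,
    strictLt (le Ψ) ω₁ ω₂ → strictLt (le (div Ψ α)) ω₁ ω₂

/-- (CR11). -/
def CR11 (div : E → Set W → E) (le : E → W → W → Prop) : Prop :=
  ∀ (Ψ : E) (α : Set W), ∀ ω₁ ∈ αᶜ, ∀ ω₂ ∈ α,
    le Ψ ω₁ ω₂ → le (div Ψ α) ω₁ ω₂

end IteratedContraction

namespace IteratedContraction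

theorem minSet_congr {W : Type*} {r s : W → W → Prop} {S : Set W}
    (h : ∀ x ∈ S, ∀ y ∈ S, (r x y ↔ s x y)) : minSet r S = minSet s S :=
  Set.ext fun x => and_congr_right fun hx => forall₂_congr fun y hy => h x hx y hy

theorem mem_minSet_pair {W : Type*} {r : W → W → Prop} (hr : ∀ z, r z z) {x y : W} :
    x ∈ minSet r {x, y} ↔ r x y := by
  have := hr x
  simp [minSet, this]

theorem FaithfulAssignment.le_of_mem {W E : Type*} {Mod : E → Set W} {le : E → W → W → Prop}
    (hF : FaithfulAssignment Mod le) {Ψ : E} {x : W} (hx : x ∈ Mod Ψ) (y : W) : le Ψ x y := by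
  by_cases hy : y ∈ Mod Ψ
  · exact (hF.2.1 Ψ x hx y hy).1
  · exact (hF.2.2 Ψ x hx y hy).1

/-- Among the worlds outside `α`, the models of `Ψ ÷ α` are exactly the minimal ones. -/
theorem Represents.mod_div_inter_compl {W E : Type*} {Mod : E → Set W} {div : E → Set W → E}
    {le : E → W → W → Prop} (hR : Represents Mod div le) (hF : FaithfulAssignment Mod le)
    (Ψ : E) (α : Set W) : Mod (div Ψ α) ∩ αᶜ = minSet (le Ψ) αᶜ := by
  rw [hR]
  ext x
  constructor
  · rintro ⟨hx | hx, hxα⟩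
    · exact ⟨hxα, fun y _ => hF.le_of_mem hx y⟩
    · exact hx
  · exact fun hx => ⟨Or.inr hx, hx.1⟩

theorem Represents.mod_div_inter_self {W E : Type*} {Mod : E → Set W} {div : E → Set W → E}
    {le : E → W → W → Prop} (hR : Represents Mod div le)
    (Ψ : E) (α : Set W) : Mod (div Ψ α) ∩ α = Mod Ψ ∩ α := by
  rw [hR]
  ext x
  constructor
  · rintro ⟨hx | hx, hxα⟩
    · exact ⟨hx, hxα⟩
    · exact absurd hxα hx.1
  · exact fun hx => ⟨Or.inl hx.1, hx.2⟩

/-- A faithful assignment representing `÷` is determined by contractions with complements of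
pairs of worlds. -/
theorem Represents.le_iff {W E : Type*} {Mod : E → Set W} {div : E → Set W → E}
    {le : E → W → W → Prop} (hR : Represents Mod div le) (hF : FaithfulAssignment Mod le)
    (Ψ : E) (x y : W) : le Ψ x y ↔ x ∈ Mod (div Ψ {x, y}ᶜ) := by
  have h := hR.mod_div_inter_compl hF Ψ {x, y}ᶜ
  rw [compl_compl] at h
  rw [← mem_minSet_pair (hF.1 Ψ).1, ← h]
  simp

theorem Represents.cr8_of_c8 {W E : Type*} {Mod : E → Set W} {div : E → Set W → E}
    {le : E → W → W → Prop} (hR : Represents Mod div le) (hF : FaithfulAssignment Mod le)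
    (h : C8 Mod div) : CR8 div le := by
  intro Ψ α x hx y hy
  have hsub : αᶜ ⊆ ({x, y} : Set W)ᶜ :=
    Set.compl_subset_compl.2 (Set.pair_subset hx hy)
  have hx' := Set.ext_iff.1 (h Ψ α _ hsub) x
  rw [hR.le_iff hF, hR.le_iff hF]
  simpa [hx] using hx'.symm

theorem Represents.cr9_of_c9 {W E : Type*} {Mod : E → Set W} {div : E → Set W → E}
    {le : E → W → W → Prop} (hR : Represents Mod div le) (hF : FaithfulAssignment Mod le)
    (h : C9 Mod div) : CR9 div le := by
  intro Ψ α x hx y hy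
  have hsub : α ⊆ ({x, y} : Set W)ᶜ :=
    Set.subset_compl_comm.1 (Set.pair_subset hx hy)
  have hx' := Set.ext_iff.1 (h Ψ α _ hsub) x
  rw [hR.le_iff hF, hR.le_iff hF]
  simpa using hx'.symm

theorem Represents.c8_of_cr8 {W E : Type*} {Mod : E → Set W} {div : E → Set W → E}
    {le : E → W → W → Prop} (hR : Represents Mod div le) (h : CR8 div le) : C8 Mod div := by
  intro Ψ α β hαβ
  have hβα : βᶜ ⊆ α := Set.compl_subset_comm.1 hαβ
  rw [hR (div Ψ α) β, hR Ψ β, Set.union_inter_distrib_right, Set.union_inter_distrib_right,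
    hR.mod_div_inter_self,
    minSet_congr fun x hx y hy => h Ψ α x (hβα hx) y (hβα hy)]

theorem Represents.c9_of_cr9 {W E : Type*} {Mod : E → Set W} {div : E → Set W → E}
    {le : E → W → W → Prop} (hR : Represents Mod div le) (hF : FaithfulAssignment Mod le)
    (h : CR9 div le) : C9 Mod div := by
  intro Ψ α β hαβ
  have hβα : βᶜ ⊆ αᶜ := Set.compl_subset_compl.2 hαβ
  rw [hR.mod_div_inter_compl hF, hR.mod_div_inter_compl hF,
    minSet_congr fun x hx y hy => h Ψ α x (hβα hx) y (hβα hy)]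

end IteratedContraction

open IteratedContraction

theorem c8_c9_representation {W E : Type*} [Finite W] [Nonempty W]
    (Mod : E → Set W) (div : E → Set W → E)
    (hAGM : ∃ le : E → W → W → Prop, FaithfulAssignment Mod le ∧ Represents Mod div le) :
    (C8 Mod div ∧ C9 Mod div) ↔
      ∃ le : E → W → W → Prop, FaithfulAssignment Mod le ∧ Represents Mod div le ∧
        CR8 div le ∧ CR9 div le := by
  constructor
  · rintro ⟨h8, h9⟩
    obtain ⟨le, hF, hR⟩ := hAGM
    exact ⟨le, hF, hR, hR.cr8_of_c8 hF h8, hR.cr9_of_c9 hF h9⟩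
  · rintro ⟨le, hF, hR, h8, h9⟩
    exact ⟨hR.c8_of_cr8 h8, hR.c9_of_cr9 hF h9⟩
end

section
/- Let ÷ be a belief change operator satisfying (C8) [for all Ψ, α, β with ¬α ⊨ β, Mod(Ψ÷α÷β) ∩ α = Mod(Ψ÷β) ∩ α], and let Ψ ↦ ≤_Ψ be any faithful assignment representing ÷. Then the assignment satisfies (CR8): for all Ψ, α and all ω₁, ω₂ ∈ α, ω₁ ≤_Ψ ω₂ if and only if ω₁ ≤_{Ψ÷α} ω₂. -/
open IteratedContraction

/-- The order of two worlds can be read off from the contraction by the complement of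
the pair they form. -/
theorem le_iff_mem_div_compl_pair {W E : Type*} {Mod : E → Set W} {div : E → Set W → E}
    {le : E → W → W → Prop} (hfa : FaithfulAssignment Mod le) (hrep : Represents Mod div le)
    (Φ : E) (ω₁ ω₂ : W) :
    le Φ ω₁ ω₂ ↔ ω₁ ∈ Mod (div Φ {ω₁, ω₂}ᶜ) := by
  obtain ⟨hpre, hmod, hlt⟩ := hfa
  rw [hrep, compl_compl]
  constructor
  · intro h
    refine Or.inr ⟨Set.mem_insert _ _, ?_⟩
    rintro ω (rfl | rfl)
    · exact (hpre Φ).1 _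
    · exact h
  · rintro (h | h)
    · by_cases h₂ : ω₂ ∈ Mod Φ
      · exact (hmod Φ ω₁ h ω₂ h₂).1
      · exact (hlt Φ ω₁ h ω₂ h₂).1
    · exact h.2 ω₂ (Set.mem_insert_of_mem _ rfl)

theorem c8_implies_cr8 {W E : Type*} [Finite W] [Nonempty W]
    (Mod : E → Set W) (div : E → Set W → E)
    (le : E → W → W → Prop)
    (hfa : FaithfulAssignment Mod le) (hrep : Represents Mod div le)
    (hc8 : C8 Mod div) :
    CR8 div le := by
  intro Ψ α ω₁ h₁ ω₂ h₂
  have hsub : αᶜ ⊆ ({ω₁, ω₂} : Set W)ᶜ :=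
    Set.compl_subset_compl.2 (Set.insert_subset h₁ (Set.singleton_subset_iff.2 h₂))
  have hmem := Set.ext_iff.1 (hc8 Ψ α _ hsub) ω₁
  simp only [Set.mem_inter_iff, h₁, and_true] at hmem
  rw [le_iff_mem_div_compl_pair hfa hrep, le_iff_mem_div_compl_pair hfa hrep, hmem]
end

section
/- Let ÷ be a belief change operator satisfying (C9) [for all Ψ, α, β with α ⊨ β, Mod(Ψ÷α÷β) ∩ ¬β = Mod(Ψ÷β) ∩ ¬β], and let Ψ ↦ ≤_Ψ be any faithful assignment representing ÷. Then the assignment satisfies (CR9): for all Ψ, α and all ω₁, ω₂ ∈ ¬α, ω₁ ≤_Ψ ω₂ if and only if ω₁ ≤_{Ψ÷α} ω₂. -/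
open IteratedContraction

/-- Under a representing faithful assignment, `ω₁` is a model of the contraction by
`{ω₁, ω₂}ᶜ` exactly when it is at least as plausible as `ω₂`. -/
theorem mem_contraction_compl_pair_iff {W E : Type*} {Mod : E → Set W} {div : E → Set W → E}
    {le : E → W → W → Prop} (hfa : FaithfulAssignment Mod le) (hrep : Represents Mod div le)
    (Ψ : E) (ω₁ ω₂ : W) :
    ω₁ ∈ Mod (div Ψ {ω₁, ω₂}ᶜ) ↔ le Ψ ω₁ ω₂ := by
  obtain ⟨hpre, hmod, hlt⟩ := hfa
  rw [hrep, compl_compl]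
  constructor
  · rintro (h | h)
    · by_cases h₂ : ω₂ ∈ Mod Ψ
      · exact (hmod Ψ ω₁ h ω₂ h₂).1
      · exact (hlt Ψ ω₁ h ω₂ h₂).1
    · exact h.2 ω₂ (Or.inr rfl)
  · intro h
    refine Or.inr ⟨Or.inl rfl, ?_⟩
    rintro ω (rfl | rfl)
    · exact (hpre Ψ).1 _
    · exact h

theorem c9_implies_cr9 {W E : Type*} [Finite W] [Nonempty W]
    (Mod : E → Set W) (div : E → Set W → E)
    (le : E → W → W → Prop)
    (hfa : FaithfulAssignment Mod le) (hrep : Represents Mod div le)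
    (hc9 : C9 Mod div) :
    CR9 div le := by
  intro Ψ α ω₁ h₁ ω₂ h₂
  have hsub : α ⊆ ({ω₁, ω₂} : Set W)ᶜ := by
    rintro ω hω (rfl | rfl)
    · exact h₁ hω
    · exact h₂ hω
  have h := Set.ext_iff.mp (hc9 Ψ α _ hsub) ω₁
  rw [compl_compl, Set.mem_inter_iff, Set.mem_inter_iff,
    and_iff_left (Set.mem_insert ω₁ {ω₂}), and_iff_left (Set.mem_insert ω₁ {ω₂}),
    mem_contraction_compl_pair_iff hfa hrep, mem_contraction_compl_pair_iff hfa hrep] at h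
  exact h.symm
end

section
/- There exist a finite nonempty set W of worlds, a type E of epistemic states with models map Mod : E → P(W), a belief change operator ÷ : E × P(W) → E, and a faithful assignment Ψ ↦ ≤_Ψ representing ÷ that satisfies (CR9) [for ω₁, ω₂ ∈ ¬α: ω₁ ≤_Ψ ω₂ ⟺ ω₁ ≤_{Ψ÷α} ω₂], but which violates (C9′): there are a state Ψ and propositions α, β with α ⊨ β such that Mod(Ψ÷α÷β) ∩ ¬α ≠ Mod(Ψ÷β) ∩ ¬α. -/
open IteratedContraction

namespace IteratedContraction

/-- The models of a state in the two-world example: `true` is always a model, `false` is one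
exactly when the state `Ψ` holds. -/
def exampleMod (Ψ : Prop) : Set Bool := {ω | ω = true ∨ Ψ}

/-- Contraction by `α` adds `false` to the models exactly when `false` is the only world
outside `α`. -/
def exampleDiv (Ψ : Prop) (α : Set Bool) : Prop := Ψ ∨ (true ∈ α ∧ false ∉ α)

/-- The two-layer order with the models below the non-models. -/
def exampleLe (Ψ : Prop) (ω₁ ω₂ : Bool) : Prop := ω₂ ∈ exampleMod Ψ → ω₁ ∈ exampleMod Ψ

theorem faithfulAssignment_example : FaithfulAssignment exampleMod exampleLe := by
  refine ⟨fun Ψ => ⟨fun _ h => h, fun _ _ _ h₁ h₂ h => h₁ (h₂ h), fun x y => ?_⟩,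
    fun Ψ x hx y hy => ⟨fun _ => hx, fun _ => hy⟩,
    fun Ψ x hx y hy => ⟨fun _ => hx, fun h => hy (h hx)⟩⟩
  unfold exampleLe
  tauto

theorem represents_example : Represents exampleMod exampleDiv exampleLe := by
  intro Ψ α
  ext ω
  cases ω
  · simp [exampleMod, exampleDiv, exampleLe, minSet]
    tauto
  · simp [exampleMod]

theorem cr9_example : CR9 exampleDiv exampleLe := by
  intro Ψ α ω₁ h₁ ω₂ h₂
  cases ω₁ <;> cases ω₂ <;> simp_all [exampleMod, exampleDiv, exampleLe]

end IteratedContraction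

theorem cr9_not_implies_c9dash :
    ∃ (W E : Type) (_ : Finite W) (_ : Nonempty W)
      (Mod : E → Set W) (div : E → Set W → E) (le : E → W → W → Prop),
      FaithfulAssignment Mod le ∧ Represents Mod div le ∧ CR9 div le ∧
        ∃ (Ψ : E) (α β : Set W), α ⊆ β ∧
          Mod (div (div Ψ α) β) ∩ αᶜ ≠ Mod (div Ψ β) ∩ αᶜ := by
  refine ⟨Bool, Prop, inferInstance, inferInstance, exampleMod, exampleDiv, exampleLe,
    faithfulAssignment_example, represents_example, cr9_example,
    False, {true}, Set.univ, Set.subset_univ _, fun h => ?_⟩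
  have := congrArg (false ∈ ·) h
  simp [exampleMod, exampleDiv] at this
end

section
/- Let ÷ be an AGM contraction operator for epistemic states. Then: ÷ satisfies (C8) [if ¬α ⊨ β then Mod(Ψ÷α÷β) ∩ α = Mod(Ψ÷β) ∩ α] if and only if ÷ satisfies (C8cond) [if ¬α ⊨ β then for every γ: Ψ÷α ⊨ ((γ ∪ ¬α) ⇃ β) ⟺ Ψ ⊨ ((γ ∪ ¬α) ⇃ β)]; and ÷ satisfies (C9) [if α ⊨ β then Mod(Ψ÷α÷β) ∩ ¬β = Mod(Ψ÷β) ∩ ¬β] if and only if ÷ satisfies (C9cond) [if α ⊨ β then for every γ: Ψ÷α ⊨ ((γ ∪ β) ⇃ β) ⟺ Ψ ⊨ ((γ ∪ β) ⇃ β)]. -/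
open IteratedContraction

/-- Two sets agree on `S` iff they are contained in the same sets of the form `T ∪ Sᶜ`. -/
theorem Set.inter_eq_inter_iff_forall_subset_union_compl {X : Type*} {A B S : Set X} :
    A ∩ S = B ∩ S ↔ ∀ T : Set X, A ⊆ T ∪ Sᶜ ↔ B ⊆ T ∪ Sᶜ := by
  have key (C T : Set X) : C ⊆ T ∪ Sᶜ ↔ C ∩ S ⊆ T := by
    rw [Set.inter_subset, Set.union_comm]
  simp only [key]
  exact ⟨fun h T => by rw [h],
    fun h => ((h _).2 subset_rfl).antisymm ((h _).1 subset_rfl)⟩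

theorem c8_c9_conditional {W E : Type*} [Finite W] [Nonempty W]
    (Mod : E → Set W) (div : E → Set W → E)
    (hAGM : ∃ le : E → W → W → Prop, FaithfulAssignment Mod le ∧ Represents Mod div le) :
    (C8 Mod div ↔ C8cond Mod div) ∧ (C9 Mod div ↔ C9cond Mod div) := by
  refine ⟨?_, ?_⟩
  · simp only [C8, C8cond, Set.inter_eq_inter_iff_forall_subset_union_compl]
    exact ⟨fun h Ψ α β γ hαβ => h Ψ α β hαβ γ, fun h Ψ α β hαβ γ => h Ψ α β γ hαβ⟩
  · simp only [C9, C9cond, Set.inter_eq_inter_iff_forall_subset_union_compl, compl_compl]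
    exact ⟨fun h Ψ α β γ hαβ => h Ψ α β hαβ γ, fun h Ψ α β hαβ γ => h Ψ α β γ hαβ⟩
end

section
/- Let ÷ be a belief change operator that is represented by a faithful assignment and satisfies (C8) and (C9). Then the following are equivalent: (a) ÷ satisfies (C10) [if ¬α ⊨ γ then Ψ÷β ⊨ γ implies Ψ÷α÷β ⊨ γ] and (C11) [if α ⊨ γ then Ψ÷α÷β ⊨ γ implies Ψ÷β ⊨ γ]; (b) there is a faithful assignment Ψ ↦ ≤_Ψ representing ÷ satisfying (CR10) [for ω₁ ∈ ¬α, ω₂ ∈ α: ω₁ <_Ψ ω₂ implies ω₁ <_{Ψ÷α} ω₂] and (CR11) [for ω₁ ∈ ¬α, ω₂ ∈ α: ω₁ ≤_Ψ ω₂ implies ω₁ ≤_{Ψ÷α} ω₂]. -/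
open IteratedContraction

namespace IteratedContraction

variable {W E : Type*}

theorem FaithfulAssignment.strictLt_of_not_le {Mod : E → Set W} {le : E → W → W → Prop}
    (hF : FaithfulAssignment Mod le) {Ψ : E} {x y : W} (h : ¬ le Ψ x y) :
    strictLt (le Ψ) y x :=
  ⟨((hF.1 Ψ).2.2 x y).resolve_left h, h⟩

/-- The order of a representing assignment is determined by contractions by `{x, y}ᶜ`. -/
theorem mem_mod_div_pair_compl_iff {Mod : E → Set W} {div : E → Set W → E}
    {le : E → W → W → Prop} (hF : FaithfulAssignment Mod le) (hR : Represents Mod div le)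
    (Ψ : E) (x y : W) : x ∈ Mod (div Ψ {x, y}ᶜ) ↔ le Ψ x y := by
  rw [hR, compl_compl]
  constructor
  · rintro (hx | hx)
    · by_cases hy : y ∈ Mod Ψ
      · exact (hF.2.1 Ψ x hx y hy).1
      · exact (hF.2.2 Ψ x hx y hy).1
    · exact hx.2 y (by simp)
  · intro h
    refine Or.inr ⟨by simp, ?_⟩
    rintro z (rfl | rfl)
    · exact (hF.1 Ψ).1 z
    · exact h

theorem mod_subset_mod_div {Mod : E → Set W} {div : E → Set W → E}
    {le : E → W → W → Prop} (hR : Represents Mod div le) (Ψ : E) (α : Set W) :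
    Mod Ψ ⊆ Mod (div Ψ α) := by
  rw [hR]
  exact Set.subset_union_left

theorem CR8.of_C8 {Mod : E → Set W} {div : E → Set W → E} {le : E → W → W → Prop}
    (hF : FaithfulAssignment Mod le) (hR : Represents Mod div le) (h : C8 Mod div) :
    CR8 div le := by
  intro Ψ α x hx y hy
  have hsub : αᶜ ⊆ ({x, y} : Set W)ᶜ :=
    Set.compl_subset_compl.2 (Set.pair_subset hx hy)
  have := Set.ext_iff.1 (h Ψ α _ hsub) x
  rw [← mem_mod_div_pair_compl_iff hF hR, ← mem_mod_div_pair_compl_iff hF hR]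
  simpa [hx] using this.symm

theorem CR9.of_C9 {Mod : E → Set W} {div : E → Set W → E} {le : E → W → W → Prop}
    (hF : FaithfulAssignment Mod le) (hR : Represents Mod div le) (h : C9 Mod div) :
    CR9 div le := by
  intro Ψ α x hx y hy
  have hsub : α ⊆ ({x, y} : Set W)ᶜ :=
    Set.subset_compl_comm.1 (Set.pair_subset hx hy)
  have := Set.ext_iff.1 (h Ψ α _ hsub) x
  rw [← mem_mod_div_pair_compl_iff hF hR, ← mem_mod_div_pair_compl_iff hF hR]
  simpa using this.symm

theorem CR10.of_C10 {Mod : E → Set W} {div : E → Set W → E} {le : E → W → W → Prop}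
    (hF : FaithfulAssignment Mod le) (hR : Represents Mod div le) (h : C10 Mod div) :
    CR10 div le := by
  intro Ψ α x hx y hy hlt
  apply hF.strictLt_of_not_le
  rw [← mem_mod_div_pair_compl_iff hF hR, ← Set.subset_compl_singleton_iff]
  refine h Ψ α _ _ (Set.subset_compl_singleton_iff.2 fun hy' => hy' hy) ?_
  rw [Set.subset_compl_singleton_iff, mem_mod_div_pair_compl_iff hF hR]
  exact hlt.2

theorem CR11.of_C11 {Mod : E → Set W} {div : E → Set W → E} {le : E → W → W → Prop}
    (hF : FaithfulAssignment Mod le) (hR : Represents Mod div le) (h : C11 Mod div) :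
    CR11 div le := by
  intro Ψ α x hx y _ hle
  by_contra hn
  rw [← mem_mod_div_pair_compl_iff hF hR, ← Set.subset_compl_singleton_iff] at hn
  have := h Ψ α _ _ (Set.subset_compl_singleton_iff.2 hx) hn
  rw [Set.subset_compl_singleton_iff, mem_mod_div_pair_compl_iff hF hR] at this
  exact this hle

theorem C10.of_CR8_of_CR10 {Mod : E → Set W} {div : E → Set W → E} {le : E → W → W → Prop}
    (hF : FaithfulAssignment Mod le) (hR : Represents Mod div le)
    (h8 : CR8 div le) (h10 : CR10 div le) : C10 Mod div := by
  intro Ψ α β γ hα hβ x hx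
  by_contra hxγ
  have hxα : x ∈ α := by
    by_contra hn
    exact hxγ (hα hn)
  have hxΨ : x ∉ Mod Ψ := fun hm => hxγ (hβ (mod_subset_mod_div hR Ψ β hm))
  rw [hR, hR] at hx
  obtain (hm | hm) | hm := hx
  · exact hxΨ hm
  · exact hm.1 hxα
  · refine hxγ (hβ ?_)
    rw [hR]
    refine Or.inr ⟨hm.1, fun y hy => ?_⟩
    by_contra hn
    by_cases hyα : y ∈ α
    · exact hn ((h8 Ψ α x hxα y hyα).2 (hm.2 y hy))
    · exact (h10 Ψ α y hyα x hxα (hF.strictLt_of_not_le hn)).2 (hm.2 y hy)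

theorem C11.of_CR9_of_CR11 {Mod : E → Set W} {div : E → Set W → E} {le : E → W → W → Prop}
    (hR : Represents Mod div le) (h9 : CR9 div le) (h11 : CR11 div le) : C11 Mod div := by
  intro Ψ α β γ hα hβ x hx
  by_contra hxγ
  have hxα : x ∉ α := fun hm => hxγ (hα hm)
  refine hxγ (hβ ?_)
  rw [hR] at hx
  obtain hm | hm := hx
  · exact mod_subset_mod_div hR _ β (mod_subset_mod_div hR Ψ α hm)
  · rw [hR]
    refine Or.inr ⟨hm.1, fun y hy => ?_⟩
    by_cases hyα : y ∈ α
    · exact h11 Ψ α x hxα y hyα (hm.2 y hy)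
    · exact (h9 Ψ α x hxα y hyα).1 (hm.2 y hy)

end IteratedContraction

theorem c10_c11_representation {W E : Type*} [Finite W] [Nonempty W]
    (Mod : E → Set W) (div : E → Set W → E)
    (hAGM : ∃ le : E → W → W → Prop, FaithfulAssignment Mod le ∧ Represents Mod div le)
    (hc8 : C8 Mod div) (hc9 : C9 Mod div) :
    (C10 Mod div ∧ C11 Mod div) ↔
      ∃ le : E → W → W → Prop, FaithfulAssignment Mod le ∧ Represents Mod div le ∧
        CR10 div le ∧ CR11 div le := by
  constructor
  · rintro ⟨h10, h11⟩
    obtain ⟨le, hF, hR⟩ := hAGM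
    exact ⟨le, hF, hR, .of_C10 hF hR h10, .of_C11 hF hR h11⟩
  · rintro ⟨le, hF, hR, h10, h11⟩
    exact ⟨.of_CR8_of_CR10 hF hR (.of_C8 hF hR hc8) h10,
      .of_CR9_of_CR11 hR (.of_C9 hF hR hc9) h11⟩
end

section
/- Let ÷ be a belief change operator and Ψ ↦ ≤_Ψ a faithful assignment representing ÷ that satisfies (CR8) [for ω₁, ω₂ ∈ α: ω₁ ≤_Ψ ω₂ ⟺ ω₁ ≤_{Ψ÷α} ω₂] and (CR10) [for ω₁ ∈ ¬α, ω₂ ∈ α: ω₁ <_Ψ ω₂ implies ω₁ <_{Ψ÷α} ω₂]. Then ÷ satisfies (C10): for all Ψ, α, β, γ with ¬α ⊨ γ, if Mod(Ψ÷β) ⊆ γ then Mod(Ψ÷α÷β) ⊆ γ. -/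
open IteratedContraction

theorem cr8_cr10_implies_c10 {W E : Type*} [Finite W] [Nonempty W]
    (Mod : E → Set W) (div : E → Set W → E)
    (le : E → W → W → Prop)
    (hfa : FaithfulAssignment Mod le) (hrep : Represents Mod div le)
    (hcr8 : CR8 div le) (hcr10 : CR10 div le) :
    C10 Mod div := by
  intro Ψ α β γ hαγ hβγ ω hω
  by_contra hωγ
  have hωα : ω ∈ α := by
    by_contra h
    exact hωγ (hαγ h)
  rw [hrep Ψ β] at hβγ
  rw [hrep (div Ψ α) β, hrep Ψ α] at hω
  rcases hω with (hΨ | hmin) | ⟨hωβ, hmin⟩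
  · exact hωγ (hβγ (Or.inl hΨ))
  · exact hmin.1 hωα
  · refine hωγ (hβγ (Or.inr ⟨hωβ, fun ω' hω' => ?_⟩))
    by_cases hω'α : ω' ∈ α
    · exact (hcr8 Ψ α ω hωα ω' hω'α).2 (hmin ω' hω')
    · by_contra hnle
      have hlt : strictLt (le Ψ) ω' ω :=
        ⟨((hfa.1 Ψ).2.2 ω ω').resolve_left hnle, hnle⟩
      exact (hcr10 Ψ α ω' hω'α ω hωα hlt).2 (hmin ω' hω')
end

section
/- Let ÷ be a belief change operator and Ψ ↦ ≤_Ψ a faithful assignment representing ÷ that satisfies (CR9) [for ω₁, ω₂ ∈ ¬α: ω₁ ≤_Ψ ω₂ ⟺ ω₁ ≤_{Ψ÷α} ω₂] and (CR11) [for ω₁ ∈ ¬α, ω₂ ∈ α: ω₁ ≤_Ψ ω₂ implies ω₁ ≤_{Ψ÷α} ω₂]. Then ÷ satisfies (C11): for all Ψ, α, β, γ with α ⊨ γ, if Mod(Ψ÷α÷β) ⊆ γ then Mod(Ψ÷β) ⊆ γ. -/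
open IteratedContraction

theorem cr9_cr11_implies_c11 {W E : Type*} [Finite W] [Nonempty W]
    (Mod : E → Set W) (div : E → Set W → E)
    (le : E → W → W → Prop)
    (hfa : FaithfulAssignment Mod le) (hrep : Represents Mod div le)
    (hcr9 : CR9 div le) (hcr11 : CR11 div le) :
    C11 Mod div := by
  intro Ψ α β γ hαγ hsub ω hω
  by_contra hωγ
  have hωα : ω ∈ αᶜ := fun h => hωγ (hαγ h)
  apply hωγ
  apply hsub
  rw [hrep, hrep]
  rw [hrep] at hω
  rcases hω with hω | ⟨hωβ, hmin⟩
  · exact Or.inl (Or.inl hω)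
  · refine Or.inr ⟨hωβ, fun ω' hω' => ?_⟩
    by_cases h : ω' ∈ α
    · exact hcr11 Ψ α ω hωα ω' h (hmin ω' hω')
    · exact (hcr9 Ψ α ω hωα ω' h).mp (hmin ω' hω')
end

section
/- Let ÷ be a belief change operator satisfying (C10) [for all Ψ, α, β, γ with ¬α ⊨ γ: Mod(Ψ÷β) ⊆ γ implies Mod(Ψ÷α÷β) ⊆ γ], and let Ψ ↦ ≤_Ψ be any faithful assignment representing ÷. Then the assignment satisfies (CR10): for all Ψ, α and all ω₁ ∈ ¬α, ω₂ ∈ α, ω₁ <_Ψ ω₂ implies ω₁ <_{Ψ÷α} ω₂. -/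
open IteratedContraction

theorem c10_implies_cr10 {W E : Type*} [Finite W] [Nonempty W]
    (Mod : E → Set W) (div : E → Set W → E)
    (le : E → W → W → Prop)
    (hfa : FaithfulAssignment Mod le) (hrep : Represents Mod div le)
    (hc10 : C10 Mod div) :
    CR10 div le := by
  intro Ψ α ω₁ _ ω₂ hω₂ hlt
  obtain ⟨htotal, hequiv, hbelow⟩ := hfa
  have hnotMod : ω₂ ∉ Mod Ψ := by
    intro hmem
    by_cases h : ω₁ ∈ Mod Ψ
    · exact hlt.2 (hequiv Ψ ω₂ hmem ω₁ h).1
    · exact hlt.2 (hbelow Ψ ω₂ hmem ω₁ h).1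
  have hsub : Mod (div Ψ {ω₁, ω₂}ᶜ) ⊆ {ω₂}ᶜ := by
    rw [hrep, compl_compl]
    rintro ω (hω | hω) rfl
    · exact hnotMod hω
    · exact hlt.2 (hω.2 ω₁ (Set.mem_insert _ _))
  have hiter := hc10 Ψ α {ω₁, ω₂}ᶜ {ω₂}ᶜ (fun ω hω h => hω (h ▸ hω₂)) hsub
  rw [hrep, compl_compl] at hiter
  have hnle : ¬ le (div Ψ α) ω₂ ω₁ := by
    intro hle
    refine hiter (Or.inr ⟨Set.mem_insert_of_mem _ rfl, ?_⟩) rfl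
    rintro ω (rfl | rfl)
    · exact hle
    · exact (htotal _).1 _
  exact ⟨((htotal _).2.2 ω₁ ω₂).resolve_right hnle, hnle⟩
end

section
/- Let ÷ be a belief change operator satisfying (C11) [for all Ψ, α, β, γ with α ⊨ γ: Mod(Ψ÷α÷β) ⊆ γ implies Mod(Ψ÷β) ⊆ γ], and let Ψ ↦ ≤_Ψ be any faithful assignment representing ÷. Then the assignment satisfies (CR11): for all Ψ, α and all ω₁ ∈ ¬α, ω₂ ∈ α, ω₁ ≤_Ψ ω₂ implies ω₁ ≤_{Ψ÷α} ω₂. -/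
open IteratedContraction

theorem c11_implies_cr11 {W E : Type*} [Finite W] [Nonempty W]
    (Mod : E → Set W) (div : E → Set W → E)
    (le : E → W → W → Prop)
    (hfa : FaithfulAssignment Mod le) (hrep : Represents Mod div le)
    (hc11 : C11 Mod div) :
    CR11 div le := by
  intro Ψ α ω₁ h₁ ω₂ h₂ hle
  obtain ⟨htp, hmod, hlt⟩ := hfa
  by_contra hn
  have hγ : α ⊆ ({ω₁}ᶜ : Set W) := by
    rintro x hx rfl
    exact h₁ hx
  have hsub : Mod (div (div Ψ α) ({ω₁, ω₂}ᶜ)) ⊆ ({ω₁}ᶜ : Set W) := by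
    rw [hrep]
    rintro x (hx | hx) rfl
    · by_cases h : ω₂ ∈ Mod (div Ψ α)
      · exact hn (hmod _ _ hx _ h).1
      · exact hn (hlt _ _ hx _ h).1
    · exact hn (hx.2 ω₂ (by simp))
  refine hc11 Ψ α _ _ hγ hsub (a := ω₁) ?_ rfl
  rw [hrep]
  refine Or.inr ⟨by simp, ?_⟩
  rw [compl_compl]
  rintro x (rfl | rfl)
  · exact (htp Ψ).1 _
  · exact hle
end
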